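/- arXiv:1712.03772 — 4 statements merged into one kernel-verified Lean document; each statement's English description precedes it below -/
import Mathlib

section
/- For every x ∈ (0, π/2): (16/14175)·x⁷ < 1/x + sin(2x)/(2x²) − 2·cot x − (8/45)x³ + (8/945)x⁵ < (2/π)⁷·(2/π − π³/45 + π⁵/3780)·x⁷. -/
open Real

/-- Partial Taylor sums of sine and cosine. -/
noncomputable def sinT (n : ℕ) (t : ℝ) : ℝ :=
  ∑ k ∈ Finset.range n, (-1) ^ k * t ^ (2 * k + 1) / ((2 * k + 1).factorial : ℝ)

noncomputable def cosT (n : ℕ) (t : ℝ) : ℝ :=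
  ∑ k ∈ Finset.range n, (-1) ^ k * t ^ (2 * k) / ((2 * k).factorial : ℝ)

lemma hasDerivAt_sinT (n : ℕ) (t : ℝ) : HasDerivAt (sinT n) (cosT n t) t := by
  unfold sinT cosT
  apply HasDerivAt.fun_sum
  intro k _
  have h := ((hasDerivAt_pow (2 * k + 1) t).const_mul ((-1 : ℝ) ^ k)).div_const
    ((2 * k + 1).factorial : ℝ)
  convert! h using 1
  rw [Nat.factorial_succ]
  have : ((2 * k).factorial : ℝ) ≠ 0 := by positivity
  have h2 : (2 * (k : ℝ) + 1) ≠ 0 := by positivity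
  push_cast
  field_simp

lemma hasDerivAt_cosT (n : ℕ) (t : ℝ) : HasDerivAt (cosT (n + 1)) (- sinT n t) t := by
  have e : cosT (n + 1) = fun t => (∑ k ∈ Finset.range n,
      (-1) ^ (k + 1) * t ^ (2 * (k + 1)) / ((2 * (k + 1)).factorial : ℝ)) + 1 := by
    funext t
    simp [cosT, Finset.sum_range_succ']
  rw [e]
  apply HasDerivAt.add_const
  rw [sinT, ← Finset.sum_neg_distrib]
  apply HasDerivAt.fun_sum
  intro k _
  have h := ((hasDerivAt_pow (2 * (k + 1)) t).const_mul ((-1 : ℝ) ^ (k + 1))).div_const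
    ((2 * (k + 1)).factorial : ℝ)
  convert! h using 1
  rw [show 2 * (k + 1) = (2 * k + 1) + 1 by ring, Nat.factorial_succ (2 * k + 1)]
  have : ((2 * k + 1).factorial : ℝ) ≠ 0 := by positivity
  have h2 : (2 * (k : ℝ) + 1 + 1) ≠ 0 := by positivity
  push_cast
  field_simp
  ring

lemma nonneg_of_deriv {f f' : ℝ → ℝ} (h : ∀ t, HasDerivAt f (f' t) t) (h0 : f 0 = 0)
    (h' : ∀ t, 0 ≤ t → 0 ≤ f' t) (t : ℝ) (ht : 0 ≤ t) : 0 ≤ f t := by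
  have hm : MonotoneOn f (Set.Ici 0) := by
    apply monotoneOn_of_deriv_nonneg (convex_Ici 0)
    · exact fun x _ => (h x).continuousAt.continuousWithinAt
    · exact fun x _ => (h x).differentiableAt.differentiableWithinAt
    · intro x hx
      rw [interior_Ici] at hx
      rw [(h x).deriv]
      exact h' x (le_of_lt hx)
  have := hm (Set.mem_Ici.2 le_rfl) (Set.mem_Ici.2 ht) ht
  rwa [h0] at this

lemma sin_cos_taylor (n : ℕ) :
    (∀ t, 0 ≤ t → 0 ≤ (-1) ^ (n + 1) * (cos t - cosT (n + 1) t)) ∧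
    (∀ t, 0 ≤ t → 0 ≤ (-1) ^ (n + 1) * (sin t - sinT (n + 1) t)) := by
  have S : ∀ n, (∀ t, 0 ≤ t → 0 ≤ (-1) ^ (n + 1) * (cos t - cosT (n + 1) t)) →
      (∀ t, 0 ≤ t → 0 ≤ (-1) ^ (n + 1) * (sin t - sinT (n + 1) t)) := by
    intro n hn
    apply nonneg_of_deriv (f := fun t => (-1) ^ (n + 1) * (sin t - sinT (n + 1) t)) _ _ hn
    · intro t
      exact ((hasDerivAt_sin t).sub (hasDerivAt_sinT _ t)).const_mul _
    · simp [sinT]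
  have C : ∀ n, (∀ t, 0 ≤ t → 0 ≤ (-1) ^ (n + 1) * (cos t - cosT (n + 1) t)) := by
    intro n
    induction n with
    | zero => intro t _; simp [cosT, cos_le_one]
    | succ n ih =>
      apply nonneg_of_deriv (f := fun t => (-1) ^ (n + 1 + 1) * (cos t - cosT (n + 1 + 1) t)) _ _
        (S n ih)
      · intro t
        convert! ((hasDerivAt_cos t).sub (hasDerivAt_cosT _ t)).const_mul _ using 1
        ring
      · simp [cosT, Finset.sum_range_succ']
  exact ⟨C n, S n (C n)⟩

lemma sin_ge_T11 (t : ℝ) (ht : 0 ≤ t) : sinT 6 t ≤ sin t := by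
  have := (sin_cos_taylor 5).2 t ht
  norm_num at this
  linarith

/-- The tail of sine divided by `t^9` is monotone. -/
lemma sin_tail_mono (a b : ℝ) (ha : 0 < a) (hab : a ≤ b) (hb : b ≤ 4) :
    (sin a - sinT 6 a) / a ^ 9 ≤ (sin b - sinT 6 b) / b ^ 9 := by
  have hd : ∀ t : ℝ, 0 < t → HasDerivAt (fun t => (sin t - sinT 6 t) / t ^ 9)
      (((cos t - cosT 6 t) * t ^ 9 - (sin t - sinT 6 t) * (9 * t ^ 8)) / (t ^ 9) ^ 2) t := by
    intro t ht
    have := ((hasDerivAt_sin t).sub (hasDerivAt_sinT 6 t)).div (hasDerivAt_pow 9 t) (by positivity)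
    convert! this using 1
  have hm : MonotoneOn (fun t => (sin t - sinT 6 t) / t ^ 9) (Set.Icc a b) := by
    apply monotoneOn_of_deriv_nonneg (convex_Icc a b)
    · exact fun x hx => (hd x (lt_of_lt_of_le ha hx.1)).continuousAt.continuousWithinAt
    · intro x hx
      rw [interior_Icc] at hx
      exact (hd x (ha.trans hx.1)).differentiableAt.differentiableWithinAt
    · intro t ht
      rw [interior_Icc] at ht
      have t0 : 0 < t := ha.trans ht.1
      rw [(hd t t0).deriv]
      apply div_nonneg _ (by positivity)
      have h1 := (sin_cos_taylor 6).2 t t0.le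
      have h2 := (sin_cos_taylor 7).1 t t0.le
      rw [sinT, Finset.sum_range_succ, ← sinT] at h1
      rw [cosT, Finset.sum_range_succ, Finset.sum_range_succ, ← cosT] at h2
      norm_num [Nat.factorial] at h1 h2
      have t4 : t ≤ 4 := ht.2.le.trans hb
      have h3 : 0 ≤ t * (cos t - cosT 6 t) - 9 * (sin t - sinT 6 t) := by
        have e1 := mul_nonneg t0.le (sub_nonneg.2 h2)
        have e2 : 0 ≤ t ^ 13 * (16 - t ^ 2) := by
          apply mul_nonneg (by positivity); nlinarith
        have e3 : 0 ≤ t ^ 13 := by positivity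
        nlinarith
      have : (cos t - cosT 6 t) * t ^ 9 - (sin t - sinT 6 t) * (9 * t ^ 8)
        = t ^ 8 * (t * (cos t - cosT 6 t) - 9 * (sin t - sinT 6 t)) := by ring
      rw [this]
      positivity
  exact hm ⟨le_rfl, hab⟩ ⟨hab, le_rfl⟩ hab

lemma b_six : bernoulli 6 = 1 / 42 := by
  rw [bernoulli_eq_bernoulli'_of_ne_one (by decide), bernoulli'_def]
  have h5 : bernoulli' 5 = 0 := bernoulli'_eq_zero_of_odd (by decide) (by decide)
  norm_num [Finset.sum_range_succ, Nat.choose, h5]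

lemma b_eight : bernoulli 8 = -1 / 30 := by
  have h6 : bernoulli' 6 = 1 / 42 := by
    rw [← bernoulli_eq_bernoulli'_of_ne_one (by decide), b_six]
  rw [bernoulli_eq_bernoulli'_of_ne_one (by decide), bernoulli'_def]
  have h5 : bernoulli' 5 = 0 := bernoulli'_eq_zero_of_odd (by decide) (by decide)
  have h7 : bernoulli' 7 = 0 := bernoulli'_eq_zero_of_odd (by decide) (by decide)
  norm_num [Finset.sum_range_succ, Nat.choose, h5, h6, h7]

lemma zeta_six : HasSum (fun n : ℕ => (1 : ℝ) / (n : ℝ) ^ 6) (π ^ 6 / 945) := by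
  convert! hasSum_zeta_nat (k := 3) (by decide) using 1
  norm_num [b_six, Nat.factorial]
  ring

lemma zeta_eight : HasSum (fun n : ℕ => (1 : ℝ) / (n : ℝ) ^ 8) (π ^ 8 / 9450) := by
  convert! hasSum_zeta_nat (k := 4) (by decide) using 1
  norm_num [b_eight, Nat.factorial]
  ring

lemma shift {k : ℕ} (hk : k ≠ 0) {a : ℝ} (h : HasSum (fun n : ℕ => (1 : ℝ) / (n : ℝ) ^ k) a) :
    HasSum (fun n : ℕ => (1 : ℝ) / ((n : ℝ) + 1) ^ k) a := by
  have := (hasSum_nat_add_iff' 1).2 h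
  simpa [hk] using this

lemma cot_series_real (x : ℝ) (h0 : 0 < x) (h1 : x < π) :
    HasSum (fun n : ℕ => 1 / (x / π - (n + 1)) + 1 / (x / π + (n + 1)))
      (π * Real.cot x - π / x) := by
  have hz : ((x / π : ℝ) : ℂ) ∈ Complex.integerComplement := by
    rw [Complex.mem_integerComplement_iff]
    rintro ⟨m, hm⟩
    have hm' : (m : ℝ) = x / π := by exact_mod_cast hm
    have p : 0 < x / π := by positivity
    have q : x / π < 1 := (div_lt_one pi_pos).2 h1
    rw [← hm'] at p q
    have p' : 0 < m := by exact_mod_cast p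
    have q' : m < 1 := by exact_mod_cast q
    omega
  have hs := (summable_cotTerm hz).hasSum
  have e := cot_series_rep' hz
  unfold cotTerm at hs
  rw [← e] at hs
  rw [← Complex.hasSum_ofReal]
  convert! hs using 1
  · funext n
    push_cast
    rfl
  · have : (π : ℂ) ≠ 0 := by exact_mod_cast pi_ne_zero
    have : (x : ℂ) ≠ 0 := by exact_mod_cast h0.ne'
    push_cast
    rw [show (π : ℂ) * (x / π) = x by field_simp]
    field_simp

/-- Normalised remainder of the cotangent expansion. -/
noncomputable def Q (x : ℝ) : ℝ :=
  (1 / x - Real.cot x - x / 3 - x ^ 3 / 45 - 2 * x ^ 5 / 945 - x ^ 7 / 4725) / x ^ 7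

lemma Q_series (x : ℝ) (h0 : 0 < x) (h1 : x < π) :
    HasSum (fun n : ℕ => 2 * (x ^ 2 / ((((n : ℝ) + 1) * π) ^ 8 * ((((n : ℝ) + 1) * π) ^ 2 - x ^ 2))))
      (Q x) := by
  have H := ((((((cot_series_real x h0 h1).mul_left (-1 / π)).sub
    ((shift (by decide) hasSum_zeta_two).mul_left (2 * x / π ^ 2))).sub
    ((shift (by decide) hasSum_zeta_four).mul_left (2 * x ^ 3 / π ^ 4))).sub
    ((shift (by decide) zeta_six).mul_left (2 * x ^ 5 / π ^ 6))).sub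
    ((shift (by decide) zeta_eight).mul_left (2 * x ^ 7 / π ^ 8))).div_const (x ^ 7)
  have hp := pi_pos
  convert! H using 1
  · funext n
    have hn : (0 : ℝ) < n + 1 := by positivity
    have hlt : x < (n + 1) * π := by
      have : (0 : ℝ) ≤ n * π := by positivity
      nlinarith
    generalize (n : ℝ) + 1 = m at *
    have a1 : m * π - x ≠ 0 := by linarith
    have a2 : m * π + x ≠ 0 := by positivity
    have a3 : (m * π) ^ 2 - x ^ 2 ≠ 0 := by
      rw [sq_sub_sq]; exact mul_ne_zero a2 a1
    have e1 : 1 / (x / π - m) = - π / (m * π - x) := by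
      rw [div_eq_div_iff _ a1]
      · field_simp; ring
      · intro h
        apply a1
        field_simp at h
        linarith
    have e2 : 1 / (x / π + m) = π / (m * π + x) := by
      rw [div_eq_div_iff _ a2]
      · field_simp; ring
      · positivity
    have e3 : - π / (m * π - x) + π / (m * π + x) = - 2 * π * x / ((m * π) ^ 2 - x ^ 2) := by
      rw [sq_sub_sq, div_add_div _ _ a1 a2, div_eq_div_iff (mul_ne_zero a1 a2) (mul_ne_zero a2 a1)]
      ring
    rw [e1, e2, e3]
    rw [mul_pow] at a3
    field_simp
    ring
  · unfold Q
    field_simp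
    ring

lemma Q_mono (x y : ℝ) (h0 : 0 < x) (hxy : x < y) (h1 : y < π) :
    Q x + 2 * (y ^ 2 - x ^ 2) / π ^ 10 ≤ Q y := by
  have hs := (Q_series y (h0.trans hxy) h1).sub (Q_series x h0 (hxy.trans h1))
  have hp := pi_pos
  have key : ∀ m : ℝ, 1 ≤ m →
      2 * (y ^ 2 - x ^ 2) / (m * π) ^ 10 ≤ 2 * (y ^ 2 / ((m * π) ^ 8 * ((m * π) ^ 2 - y ^ 2))) -
        2 * (x ^ 2 / ((m * π) ^ 8 * ((m * π) ^ 2 - x ^ 2))) := by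
    intro m hm
    have hy : y < m * π := by nlinarith
    generalize m * π = M at *
    have M0 : 0 < M := by linarith
    have q1 : 0 < M ^ 2 - y ^ 2 := by nlinarith
    have q2 : 0 < M ^ 2 - x ^ 2 := by nlinarith
    have q3 : 0 < y ^ 2 - x ^ 2 := by nlinarith
    have e : 2 * (y ^ 2 / (M ^ 8 * (M ^ 2 - y ^ 2))) - 2 * (x ^ 2 / (M ^ 8 * (M ^ 2 - x ^ 2)))
        = 2 * (y ^ 2 - x ^ 2) / (M ^ 6 * ((M ^ 2 - y ^ 2) * (M ^ 2 - x ^ 2))) := by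
      field_simp
      ring
    rw [e]
    apply div_le_div_of_nonneg_left (by positivity) (by positivity)
    calc M ^ 6 * ((M ^ 2 - y ^ 2) * (M ^ 2 - x ^ 2)) ≤ M ^ 6 * (M ^ 2 * M ^ 2) := by
          gcongr
          · nlinarith [sq_nonneg y]
          · nlinarith [sq_nonneg x]
      _ = M ^ 10 := by ring
  have := le_hasSum hs 0 (fun n _ => by
    refine le_trans ?_ (key ((n : ℝ) + 1) (by linarith [n.cast_nonneg (α := ℝ)]))
    have : 0 ≤ y ^ 2 - x ^ 2 := by nlinarith
    positivity)
  have k1 := key 1 le_rfl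
  simp only [Nat.cast_zero, zero_add] at this
  rw [one_mul] at *
  linarith

lemma Q_lower (x : ℝ) (h0 : 0 < x) (h1 : x < π) : 2 * x ^ 2 / π ^ 10 ≤ Q x := by
  have hs := Q_series x h0 h1
  have hp := pi_pos
  have key : ∀ m : ℝ, 1 ≤ m →
      2 * x ^ 2 / (m * π) ^ 10 ≤ 2 * (x ^ 2 / ((m * π) ^ 8 * ((m * π) ^ 2 - x ^ 2))) := by
    intro m hm
    have hy : x < m * π := by nlinarith
    generalize m * π = M at *
    have M0 : 0 < M := by linarith
    have q2 : 0 < M ^ 2 - x ^ 2 := by nlinarith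
    rw [← mul_div_assoc]
    apply div_le_div_of_nonneg_left (by positivity) (by positivity)
    calc M ^ 8 * (M ^ 2 - x ^ 2) ≤ M ^ 8 * M ^ 2 := by
          gcongr
          nlinarith [sq_nonneg x]
      _ = M ^ 10 := by ring
  have := le_hasSum hs 0 (fun n _ => by
    refine le_trans ?_ (key ((n : ℝ) + 1) (by linarith [n.cast_nonneg (α := ℝ)]))
    positivity)
  have k1 := key 1 le_rfl
  simp only [Nat.cast_zero, zero_add] at this
  rw [one_mul] at *
  linarith

lemma pi_ten : (1024 / 39916800 : ℝ) < 2 * (2 / π ^ 10) := by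
  have h : π ^ 10 < 3.15 ^ 10 := by
    gcongr
    exact pi_lt_d2
  rw [← mul_div_assoc, div_lt_div_iff₀ (by norm_num) (by positivity)]
  norm_num at h ⊢
  linarith

/-- Decomposition of the function under study. -/
lemma decomp (x : ℝ) (h0 : 0 < x) :
    1 / x + Real.sin (2 * x) / (2 * x ^ 2) - 2 * Real.cot x
          - (8 / 45) * x ^ 3 + (8 / 945) * x ^ 5 =
    (16 / 14175 + 2 * Q x - 1024 / 39916800 * x ^ 2 +
      256 * ((sin (2 * x) - sinT 6 (2 * x)) / (2 * x) ^ 9)) * x ^ 7 := by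
  unfold Q
  norm_num [sinT, Finset.sum_range_succ, Nat.factorial]
  field_simp
  ring

theorem wilker_m3 (x : ℝ) (hx : x ∈ Set.Ioo 0 (π / 2)) :
    (16 / 14175) * x ^ 7
      < 1 / x + Real.sin (2 * x) / (2 * x ^ 2) - 2 * Real.cot x
          - (8 / 45) * x ^ 3 + (8 / 945) * x ^ 5 ∧
    1 / x + Real.sin (2 * x) / (2 * x ^ 2) - 2 * Real.cot x
        - (8 / 45) * x ^ 3 + (8 / 945) * x ^ 5
      < (2 / π) ^ 7 * (2 / π - π ^ 3 / 45 + π ^ 5 / 3780) * x ^ 7 := by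
  obtain ⟨h0, h1⟩ := hx
  have hp := pi_pos
  have hp4 := pi_lt_four
  have p10 := pi_ten
  have x7 : 0 < x ^ 7 := by positivity
  rw [decomp x h0]
  constructor
  · apply mul_lt_mul_of_pos_right _ x7
    have a := Q_lower x h0 (by linarith)
    have b : 0 ≤ (sin (2 * x) - sinT 6 (2 * x)) / (2 * x) ^ 9 :=
      div_nonneg (sub_nonneg.2 (sin_ge_T11 _ (by linarith))) (by positivity)
    have c := mul_lt_mul_of_pos_right p10 (show 0 < x ^ 2 by positivity)
    have d : 2 * x ^ 2 / π ^ 10 = 2 / π ^ 10 * x ^ 2 := by ring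
    rw [d] at a
    have : 0 < x ^ 2 := by positivity
    linarith
  · apply mul_lt_mul_of_pos_right _ x7
    have hD := decomp (π / 2) (by positivity)
    have hc : Real.cot (π / 2) = 0 := by rw [Real.cot_eq_cos_div_sin]; simp
    have h2 : 2 * (π / 2) = π := by ring
    rw [hc, h2, sin_pi] at hD
    have hR : (2 / π) ^ 7 * (2 / π - π ^ 3 / 45 + π ^ 5 / 3780) =
        16 / 14175 + 2 * Q (π / 2) - 1024 / 39916800 * (π / 2) ^ 2 +
          256 * ((0 - sinT 6 π) / π ^ 9) := by
      have e : (π / 2) ^ 7 * (2 / π) ^ 7 = 1 := by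
        rw [← mul_pow]; field_simp
      apply mul_right_cancel₀ (show (π / 2) ^ 7 ≠ 0 by positivity)
      rw [← hD]
      rw [mul_right_comm, mul_comm ((2 / π) ^ 7), e]
      field_simp
      ring
    rw [hR]
    have a := Q_mono x (π / 2) h0 h1 (by linarith)
    have b := sin_tail_mono (2 * x) π (by linarith) (by linarith) hp4.le
    rw [sin_pi] at b
    have q : 0 < (π / 2) ^ 2 - x ^ 2 := by nlinarith
    have c := mul_lt_mul_of_pos_right p10 q
    have d : 2 * ((π / 2) ^ 2 - x ^ 2) / π ^ 10 = 2 / π ^ 10 * ((π / 2) ^ 2 - x ^ 2) := by ring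
    rw [d] at a
    rw [mul_assoc 2 (2 / π ^ 10)] at c
    linarith
end

section
/- For every x ∈ (0,1): x⁵/180 + x⁷/189 + 23x⁹/5184 + 629x¹¹/171072 + 14929x¹³/4852224 < arcsin x − 3x/(2+√(1−x²)) < x⁵/180 + x⁷/189 + 23x⁹/5184 + 629x¹¹/171072 + (−2273701/1496880 + π/2)·x¹³. -/
open Real

noncomputable def shF (x : ℝ) : ℝ := Real.arcsin x - 3 * x / (2 + Real.sqrt (1 - x ^ 2))

noncomputable def shg (x : ℝ) : ℝ :=
  (1 - Real.sqrt (1 - x ^ 2)) ^ 2 / (Real.sqrt (1 - x ^ 2) * (2 + Real.sqrt (1 - x ^ 2)) ^ 2)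

noncomputable def shP (x : ℝ) : ℝ :=
  x ^ 5 / 180 + x ^ 7 / 189 + 23 * x ^ 9 / 5184 + 629 * x ^ 11 / 171072

noncomputable def shP1 (x : ℝ) : ℝ :=
  x ^ 4 / 36 + x ^ 6 / 27 + 23 * x ^ 8 / 576 + 629 * x ^ 10 / 15552

noncomputable def shP2 (x : ℝ) : ℝ :=
  x ^ 3 / 9 + 2 * x ^ 5 / 9 + 23 * x ^ 7 / 72 + 3145 * x ^ 9 / 7776

theorem sh_s {x : ℝ} (h0 : 0 ≤ x) (h1 : x < 1) :
    0 < Real.sqrt (1 - x ^ 2) ∧ x ^ 2 = 1 - Real.sqrt (1 - x ^ 2) ^ 2 := by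
  have h : 0 < 1 - x ^ 2 := by nlinarith
  refine ⟨Real.sqrt_pos.2 h, ?_⟩
  rw [Real.sq_sqrt h.le]; ring

theorem sh_s_lt {x : ℝ} (h0 : 0 < x) (h1 : x < 1) : Real.sqrt (1 - x ^ 2) < 1 := by
  obtain ⟨hs, h⟩ := sh_s h0.le h1
  nlinarith [pow_pos h0 2]

theorem sh_ds {x : ℝ} (h0 : 0 ≤ x) (h1 : x < 1) :
    HasDerivAt (fun y : ℝ => Real.sqrt (1 - y ^ 2)) (-x / Real.sqrt (1 - x ^ 2)) x := by
  have h : 1 - x ^ 2 ≠ 0 := by nlinarith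
  have := (((hasDerivAt_id x).pow 2).const_sub 1).sqrt (by simpa using h)
  refine HasDerivAt.congr_deriv this ?_
  have h2 := (sh_s h0 h1).1.ne'
  change -(((2 : ℕ) : ℝ) * x ^ (2 - 1) * 1) / (2 * √(1 - x ^ 2)) = _
  field_simp
  norm_num

theorem sh_dF {x : ℝ} (h0 : 0 ≤ x) (h1 : x < 1) : HasDerivAt shF (shg x) x := by
  obtain ⟨hs, h⟩ := sh_s h0 h1
  have := (Real.hasDerivAt_arcsin (x := x) (by linarith) (by linarith)).sub
    (((hasDerivAt_id x).const_mul 3).div ((sh_ds h0 h1).const_add 2) (by positivity))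
  refine HasDerivAt.congr_deriv this ?_
  unfold shg
  simp only [id]
  generalize Real.sqrt (1 - x ^ 2) = s at *
  field_simp
  rw [h]; ring

theorem sh_dP (x : ℝ) : HasDerivAt shP (shP1 x) x := by
  have hp := fun n : ℕ => hasDerivAt_pow n x
  have := ((((hp 5).div_const 180).add ((hp 7).div_const 189)).add
    (((hp 9).const_mul 23).div_const 5184)).add (((hp 11).const_mul 629).div_const 171072)
  refine HasDerivAt.congr_deriv this ?_
  unfold shP1; push_cast; ring

theorem sh_dP1 (x : ℝ) : HasDerivAt shP1 (shP2 x) x := by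
  have hp := fun n : ℕ => hasDerivAt_pow n x
  have := ((((hp 4).div_const 36).add ((hp 6).div_const 27)).add
    (((hp 8).const_mul 23).div_const 576)).add (((hp 10).const_mul 629).div_const 15552)
  refine HasDerivAt.congr_deriv this ?_
  unfold shP2; push_cast; ring

theorem sh_dg {x : ℝ} (h0 : 0 ≤ x) (h1 : x < 1) :
    HasDerivAt shg ((1 - Real.sqrt (1 - x ^ 2)) * (Real.sqrt (1 - x ^ 2) ^ 2
      - 5 * Real.sqrt (1 - x ^ 2) - 2) / (Real.sqrt (1 - x ^ 2) ^ 2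
      * (2 + Real.sqrt (1 - x ^ 2)) ^ 3) * (-x / Real.sqrt (1 - x ^ 2))) x := by
  obtain ⟨hs, h⟩ := sh_s h0 h1
  have hd := sh_ds h0 h1
  have := ((hd.const_sub 1).pow 2).div (hd.mul ((hd.const_add 2).pow 2))
    (by simp only [Pi.mul_apply, Pi.pow_apply]; positivity)
  refine HasDerivAt.congr_deriv this ?_
  simp only [Pi.mul_apply, Pi.pow_apply]
  generalize Real.sqrt (1 - x ^ 2) = s at *
  field_simp
  push_cast
  ring

theorem sh_low_deriv {x : ℝ} (h0 : 0 < x) (h1 : x < 1) :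
    0 < shg x - shP1 x - 14929 / 4852224 * (13 * x ^ 12) := by
  obtain ⟨hs, h⟩ := sh_s h0.le h1
  have hs1 := sh_s_lt h0 h1
  unfold shg shP1
  generalize Real.sqrt (1 - x ^ 2) = s at *
  rw [show x ^ 4 = (x ^ 2) ^ 2 by ring, show x ^ 6 = (x ^ 2) ^ 3 by ring,
    show x ^ 8 = (x ^ 2) ^ 4 by ring, show x ^ 10 = (x ^ 2) ^ 5 by ring,
    show x ^ 12 = (x ^ 2) ^ 6 by ring, h]
  have hm : 0 < 1 - s := by linarith
  have : 0 < (1 - s) ^ 7 * (373248 + 1589756 * s + 3386848 * s ^ 2 + 4465131 * s ^ 3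
    + 3857401 * s ^ 4 + 2192726 * s ^ 5 + 791070 * s ^ 6 + 164219 * s ^ 7 + 14929 * s ^ 8)
    / (373248 * (s * (2 + s) ^ 2)) := by positivity
  convert this using 1
  field_simp
  ring

theorem sh_up_deriv {x : ℝ} (h0 : 0 < x) (h1 : x < 1) :
    0 < x * ((1 - Real.sqrt (1 - x ^ 2)) * (Real.sqrt (1 - x ^ 2) ^ 2
      - 5 * Real.sqrt (1 - x ^ 2) - 2) / (Real.sqrt (1 - x ^ 2) ^ 2
      * (2 + Real.sqrt (1 - x ^ 2)) ^ 3) * (-x / Real.sqrt (1 - x ^ 2)) - shP2 x)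
      - 12 * (shg x - shP1 x) := by
  obtain ⟨hs, h⟩ := sh_s h0.le h1
  have hs1 := sh_s_lt h0 h1
  unfold shg shP1 shP2
  generalize Real.sqrt (1 - x ^ 2) = s at *
  have hm : 0 < 1 - s := by linarith
  have : 0 < (1 - s) ^ 7 * (15552 + 132192 * s + 349920 * s ^ 2 + 524728 * s ^ 3
    + 517756 * s ^ 4 + 348926 * s ^ 5 + 159345 * s ^ 6 + 47191 * s ^ 7 + 8177 * s ^ 8
    + 629 * s ^ 9) / (7776 * (s ^ 3 * (2 + s) ^ 3)) := by positivity
  convert this using 1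
  trans (-(x ^ 2) * ((1 - s) * (s ^ 2 - 5 * s - 2) / (s ^ 3 * (2 + s) ^ 3))
    - ((x ^ 2) ^ 2 / 9 + 2 * (x ^ 2) ^ 3 / 9 + 23 * (x ^ 2) ^ 4 / 72
      + 3145 * (x ^ 2) ^ 5 / 7776)
    - 12 * ((1 - s) ^ 2 / (s * (2 + s) ^ 2) - ((x ^ 2) ^ 2 / 36 + (x ^ 2) ^ 3 / 27
      + 23 * (x ^ 2) ^ 4 / 576 + 629 * (x ^ 2) ^ 5 / 15552)))
  · clear this h
    field_simp
  · rw [h]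
    field_simp
    ring

/-- positivity from a positive derivative -/
theorem sh_pos {f f' : ℝ → ℝ} {x : ℝ} (h0 : 0 < x) (h1 : x < 1) (hf0 : f 0 = 0)
    (hd : ∀ y, 0 ≤ y → y < 1 → HasDerivAt f (f' y) y)
    (hp : ∀ y, 0 < y → y < 1 → 0 < f' y) : 0 < f x := by
  have hm : StrictMonoOn f (Set.Icc 0 x) := by
    apply strictMonoOn_of_deriv_pos (convex_Icc 0 x)
    · intro y hy
      exact (hd y hy.1 (lt_of_le_of_lt hy.2 h1)).continuousAt.continuousWithinAt
    · intro y hy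
      rw [interior_Icc] at hy
      rw [(hd y hy.1.le (hy.2.trans h1)).deriv]
      exact hp y hy.1 (hy.2.trans h1)
  have := hm (Set.left_mem_Icc.2 h0.le) (Set.right_mem_Icc.2 h0.le) h0
  rwa [hf0] at this

theorem sh_F0 : shF 0 = 0 := by simp [shF]
theorem sh_P0 : shP 0 = 0 := by simp [shP]

theorem sh_low {x : ℝ} (h0 : 0 < x) (h1 : x < 1) :
    0 < shF x - shP x - 14929 / 4852224 * x ^ 13 := by
  refine sh_pos (f := fun x => shF x - shP x - 14929 / 4852224 * x ^ 13)
    (f' := fun x => shg x - shP1 x - 14929 / 4852224 * (13 * x ^ 12)) h0 h1 ?_ ?_ ?_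
  · simp [sh_F0, sh_P0]
  · intro y hy hy1
    refine HasDerivAt.congr_deriv (((sh_dF hy hy1).sub (sh_dP y)).sub
      ((hasDerivAt_pow 13 y).const_mul (14929 / 4852224))) ?_
    norm_num
  · intro y hy hy1
    exact sh_low_deriv hy hy1

theorem sh_H {x : ℝ} (h0 : 0 < x) (h1 : x < 1) :
    0 < x * (shg x - shP1 x) - 13 * (shF x - shP x) := by
  refine sh_pos (f := fun x => x * (shg x - shP1 x) - 13 * (shF x - shP x))
    (f' := fun x => x * ((1 - Real.sqrt (1 - x ^ 2)) * (Real.sqrt (1 - x ^ 2) ^ 2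
      - 5 * Real.sqrt (1 - x ^ 2) - 2) / (Real.sqrt (1 - x ^ 2) ^ 2
      * (2 + Real.sqrt (1 - x ^ 2)) ^ 3) * (-x / Real.sqrt (1 - x ^ 2)) - shP2 x)
      - 12 * (shg x - shP1 x)) h0 h1 ?_ ?_ ?_
  · simp [sh_F0, sh_P0]
  · intro y hy hy1
    have := ((hasDerivAt_id y).mul ((sh_dg hy hy1).sub (sh_dP1 y))).sub
      (((sh_dF hy hy1).sub (sh_dP y)).const_mul 13)
    refine HasDerivAt.congr_deriv this ?_
    simp only [id, Pi.sub_apply]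
    ring
  · intro y hy hy1
    exact sh_up_deriv hy hy1

theorem sh_contF : Continuous shF := by
  unfold shF
  refine Real.continuous_arcsin.sub (Continuous.div (by fun_prop) (by fun_prop) ?_)
  intro x
  positivity

theorem sh_up {x : ℝ} (h0 : 0 < x) (h1 : x < 1) :
    (shF x - shP x) / x ^ 13 < shF 1 - shP 1 := by
  have hm : StrictMonoOn (fun y => (shF y - shP y) / y ^ 13) (Set.Icc x 1) := by
    apply strictMonoOn_of_deriv_pos (convex_Icc x 1)
    · apply ContinuousOn.div
      · have hP : Continuous shP := by unfold shP; fun_prop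
        exact (sh_contF.sub hP).continuousOn
      · fun_prop
      · intro y hy
        have : 0 < y := lt_of_lt_of_le h0 hy.1
        positivity
    · intro y hy
      rw [interior_Icc] at hy
      have hy0 : 0 < y := h0.trans hy.1
      have hd := ((sh_dF hy0.le hy.2).sub (sh_dP y)).div (hasDerivAt_pow 13 y)
        (by positivity)
      have hd' : deriv (fun y => (shF y - shP y) / y ^ 13) y = _ := hd.deriv
      rw [hd']
      have hH := sh_H hy0 hy.2
      have : 0 < y ^ 12 * (y * (shg y - shP1 y) - 13 * (shF y - shP y)) / (y ^ 13) ^ 2 := by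
        positivity
      convert this using 1
      simp only [Pi.sub_apply]
      congr 1
      push_cast
      ring
  have := hm (Set.left_mem_Icc.2 h1.le) (Set.right_mem_Icc.2 h1.le) h1
  simpa using this

theorem shafer3_n6 (x : ℝ) (hx : x ∈ Set.Ioo (0 : ℝ) 1) :
    x ^ 5 / 180 + x ^ 7 / 189 + 23 * x ^ 9 / 5184 + 629 * x ^ 11 / 171072
        + 14929 * x ^ 13 / 4852224
      < Real.arcsin x - 3 * x / (2 + Real.sqrt (1 - x ^ 2)) ∧
    Real.arcsin x - 3 * x / (2 + Real.sqrt (1 - x ^ 2))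
      < x ^ 5 / 180 + x ^ 7 / 189 + 23 * x ^ 9 / 5184 + 629 * x ^ 11 / 171072
        + (-(2273701 / 1496880) + π / 2) * x ^ 13 := by
  obtain ⟨h0, h1⟩ := hx
  constructor
  · have := sh_low h0 h1
    unfold shF shP at this
    linarith
  · have := sh_up h0 h1
    have h13 : 0 < x ^ 13 := by positivity
    have e : shF 1 - shP 1 = -(2273701 / 1496880) + π / 2 := by
      simp [shF, shP]
      ring
    rw [e, div_lt_iff₀ h13] at this
    unfold shF shP at this
    linarith
end

section
/- For every x ∈ (0,1): (1−π/3)·x + (1/6−π/18)·x³ + (3/40−5π/216)·x⁵ + (5/112−17π/1296)·x⁷ + (35/1152−269π/31104)·x⁹ < arcsin x − πx/(2+√(1−x²)) < (1−π/3)·x + (1/6−π/18)·x³ + (3/40−5π/216)·x⁵ + (5/112−17π/1296)·x⁷ + (−2161/1680 + 551π/1296)·x⁹. -/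
open Real

/-- The difference of the two sides, with `x = sin t` and a free last coefficient `k`. -/
noncomputable def shaferAux (k t : ℝ) : ℝ :=
  t - π * sin t / (2 + cos t) - ((1 - π / 3) * sin t + (1 / 6 - π / 18) * sin t ^ 3
    + (3 / 40 - 5 * π / 216) * sin t ^ 5 + (5 / 112 - 17 * π / 1296) * sin t ^ 7 + k * sin t ^ 9)

/-- Its derivative, as a function of `s = cos t`. -/
noncomputable def shaferDer (k s : ℝ) : ℝ :=
  1 - π * (2 * s + 1) / (2 + s) ^ 2 - s * ((1 - π / 3) + 3 * (1 / 6 - π / 18) * (1 - s ^ 2)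
    + 5 * (3 / 40 - 5 * π / 216) * (1 - s ^ 2) ^ 2 + 7 * (5 / 112 - 17 * π / 1296) * (1 - s ^ 2) ^ 3
    + 9 * k * (1 - s ^ 2) ^ 4)

lemma shaferAux_hasDerivAt (k t : ℝ) :
    HasDerivAt (shaferAux k) (shaferDer k (cos t)) t := by
  have hs := Real.hasDerivAt_sin t
  have hc := Real.hasDerivAt_cos t
  have hpos : (2 + cos t) ≠ 0 := by linarith [Real.neg_one_le_cos t]
  have h := ((hasDerivAt_id t).sub ((hs.const_mul π).div (hc.const_add 2) hpos)).sub
    (((((hs.const_mul (1 - π / 3)).add ((hs.pow 3).const_mul (1 / 6 - π / 18))).add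
      ((hs.pow 5).const_mul (3 / 40 - 5 * π / 216))).add
      ((hs.pow 7).const_mul (5 / 112 - 17 * π / 1296))).add ((hs.pow 9).const_mul k))
  refine h.congr_deriv ?_
  unfold shaferDer
  have e : 1 - cos t ^ 2 = sin t ^ 2 := by linarith [Real.sin_sq_add_cos_sq t]
  have e2 : π * cos t * (2 + cos t) - π * sin t * -sin t = π * (2 * cos t + 1) := by
    linear_combination π * Real.sin_sq_add_cos_sq t
  rw [e, e2]
  push_cast
  ring

lemma shaferAux_cont (k : ℝ) : Continuous (shaferAux k) :=
  continuous_iff_continuousAt.2 fun t => (shaferAux_hasDerivAt k t).continuousAt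

lemma shaferDer_lower (s : ℝ) (h0 : 0 < s) (h1 : s < 1) :
    0 < shaferDer (35 / 1152 - 269 * π / 31104) s := by
  have hp1 := Real.pi_gt_d4
  have hp2 := Real.pi_lt_d4
  have key : shaferDer (35 / 1152 - 269 * π / 31104) s = (1 - s) ^ 5 *
      ((4 - π) + (453 / 32 - 10001 / 2592 * π) * s + (351 / 16 - 2657 / 432 * π) * s ^ 2
      + (2405 / 128 - 18395 / 3456 * π) * s ^ 3 + (1185 / 128 - 27293 / 10368 * π) * s ^ 4
      + (315 / 128 - 269 / 384 * π) * s ^ 5 + (35 / 128 - 269 / 3456 * π) * s ^ 6)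
      / (2 + s) ^ 2 := by
    unfold shaferDer
    have : (2 + s) ≠ 0 := by linarith
    field_simp
    ring
  rw [key]
  have a0 : 0 < 4 - π := by linarith
  have a1 : 0 < 453 / 32 - 10001 / 2592 * π := by linarith
  have a2 : 0 < 351 / 16 - 2657 / 432 * π := by linarith
  have a3 : 0 < 2405 / 128 - 18395 / 3456 * π := by linarith
  have a4 : 0 < 1185 / 128 - 27293 / 10368 * π := by linarith
  have a5 : 0 < 315 / 128 - 269 / 384 * π := by linarith
  have a6 : 0 < 35 / 128 - 269 / 3456 * π := by linarith
  have a7 : 0 < 1 - s := by linarith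
  positivity

/-- The polynomial factor of the derivative for the upper bound. -/
noncomputable def shaferR (s : ℝ) : ℝ :=
  (4 - π) - ((2993 / 162 * π - 4029 / 70) * s + (13021 / 162 * π - 3427 / 14) * s ^ 2
      + (34397 / 216 * π - 135159 / 280) * s ^ 3 + (54787 / 324 * π - 71663 / 140) * s ^ 4
      + (129053 / 1296 * π - 168733 / 560) * s ^ 5 + (551 / 18 * π - 6483 / 70) * s ^ 6
      + (551 / 144 * π - 6483 / 560) * s ^ 7)

lemma shaferDer_upper (s : ℝ) (h0 : 0 ≤ s) :
    shaferDer (-(2161 / 1680) + 551 * π / 1296) s = (1 - s) ^ 4 * shaferR s / (2 + s) ^ 2 := by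
  unfold shaferDer shaferR
  have : (2 + s) ≠ 0 := by linarith
  field_simp
  ring

lemma shaferR_anti {s t : ℝ} (h0 : 0 ≤ s) (h : s < t) : shaferR t < shaferR s := by
  have hp1 := Real.pi_gt_d4
  unfold shaferR
  have a1 : 0 < 2993 / 162 * π - 4029 / 70 := by linarith
  have a2 : 0 < 13021 / 162 * π - 3427 / 14 := by linarith
  have a3 : 0 < 34397 / 216 * π - 135159 / 280 := by linarith
  have a4 : 0 < 54787 / 324 * π - 71663 / 140 := by linarith
  have a5 : 0 < 129053 / 1296 * π - 168733 / 560 := by linarith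
  have a6 : 0 < 551 / 18 * π - 6483 / 70 := by linarith
  have a7 : 0 < 551 / 144 * π - 6483 / 560 := by linarith
  gcongr

lemma shaferAux_lower {t : ℝ} (h0 : 0 < t) (h1 : t < π / 2) :
    0 < shaferAux (35 / 1152 - 269 * π / 31104) t := by
  have hm : StrictMonoOn (shaferAux (35 / 1152 - 269 * π / 31104)) (Set.Icc 0 t) := by
    refine strictMonoOn_of_deriv_pos (convex_Icc _ _) (shaferAux_cont _).continuousOn ?_
    intro u hu
    rw [interior_Icc] at hu
    rw [(shaferAux_hasDerivAt _ u).deriv]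
    apply shaferDer_lower
    · exact Real.cos_pos_of_mem_Ioo ⟨by linarith [hu.1], by linarith [hu.2]⟩
    · rw [← Real.cos_zero]
      exact Real.cos_lt_cos_of_nonneg_of_le_pi_div_two le_rfl (by linarith [hu.2]) hu.1
  have := hm (Set.left_mem_Icc.2 h0.le) (Set.right_mem_Icc.2 h0.le) h0
  simpa [shaferAux] using this

lemma shaferAux_upper {t : ℝ} (h0 : 0 < t) (h1 : t < π / 2) :
    shaferAux (-(2161 / 1680) + 551 * π / 1296) t < 0 := by
  have hct : 0 < cos t := Real.cos_pos_of_mem_Ioo ⟨by linarith, h1⟩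
  rcases le_total (shaferR (cos t)) 0 with hR | hR
  · have hm : StrictAntiOn (shaferAux (-(2161 / 1680) + 551 * π / 1296)) (Set.Icc 0 t) := by
      refine strictAntiOn_of_deriv_neg (convex_Icc _ _) (shaferAux_cont _).continuousOn ?_
      intro u hu
      rw [interior_Icc] at hu
      have hlt : cos t < cos u :=
        Real.cos_lt_cos_of_nonneg_of_le_pi_div_two hu.1.le h1.le hu.2
      have hlt1 : cos u < 1 := by
        rw [← Real.cos_zero]
        exact Real.cos_lt_cos_of_nonneg_of_le_pi_div_two le_rfl (by linarith [hu.2]) hu.1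
      rw [(shaferAux_hasDerivAt _ u).deriv, shaferDer_upper _ (hct.trans hlt).le]
      have := shaferR_anti hct.le hlt
      have h4 : 0 < (1 - cos u) ^ 4 := by
        have : 0 < 1 - cos u := by linarith
        positivity
      have h2 : 0 < (2 + cos u) ^ 2 := by
        have : 0 < 2 + cos u := by linarith
        positivity
      exact div_neg_of_neg_of_pos (mul_neg_of_pos_of_neg h4 (by linarith)) h2
    have := hm (Set.left_mem_Icc.2 h0.le) (Set.right_mem_Icc.2 h0.le) h0
    simpa [shaferAux] using this
  · have hm : StrictMonoOn (shaferAux (-(2161 / 1680) + 551 * π / 1296)) (Set.Icc t (π / 2)) := by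
      refine strictMonoOn_of_deriv_pos (convex_Icc _ _) (shaferAux_cont _).continuousOn ?_
      intro u hu
      rw [interior_Icc] at hu
      have hlt : cos u < cos t :=
        Real.cos_lt_cos_of_nonneg_of_le_pi_div_two h0.le hu.2.le hu.1
      have hcu : 0 < cos u := Real.cos_pos_of_mem_Ioo ⟨by linarith [hu.1], hu.2⟩
      have hlt1 : cos u < 1 := hlt.trans_le (Real.cos_le_one t)
      rw [(shaferAux_hasDerivAt _ u).deriv, shaferDer_upper _ hcu.le]
      have := shaferR_anti hcu.le hlt
      have h3 : 0 < shaferR (cos u) := by linarith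
      have h4 : 0 < 1 - cos u := by linarith
      positivity
    have := hm (Set.left_mem_Icc.2 h1.le) (Set.right_mem_Icc.2 h1.le) h1
    refine this.trans_eq ?_
    unfold shaferAux
    rw [Real.sin_pi_div_two, Real.cos_pi_div_two]
    ring

theorem shaferPi_n4 (x : ℝ) (hx : x ∈ Set.Ioo (0 : ℝ) 1) :
    (1 - π / 3) * x + (1 / 6 - π / 18) * x ^ 3 + (3 / 40 - 5 * π / 216) * x ^ 5
        + (5 / 112 - 17 * π / 1296) * x ^ 7 + (35 / 1152 - 269 * π / 31104) * x ^ 9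
      < Real.arcsin x - π * x / (2 + Real.sqrt (1 - x ^ 2)) ∧
    Real.arcsin x - π * x / (2 + Real.sqrt (1 - x ^ 2))
      < (1 - π / 3) * x + (1 / 6 - π / 18) * x ^ 3 + (3 / 40 - 5 * π / 216) * x ^ 5
        + (5 / 112 - 17 * π / 1296) * x ^ 7
        + (-(2161 / 1680) + 551 * π / 1296) * x ^ 9 := by
  have h0 : 0 < arcsin x := Real.arcsin_pos.2 hx.1
  have h1 : arcsin x < π / 2 := Real.arcsin_lt_pi_div_two.2 hx.2
  have hl := shaferAux_lower h0 h1
  have hu := shaferAux_upper h0 h1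
  unfold shaferAux at hl hu
  rw [Real.sin_arcsin (by linarith [hx.1]) hx.2.le, Real.cos_arcsin] at hl hu
  constructor <;> linarith
end

section
/- For every x ∈ (0,1): ( x⁵/60 + 11x⁷/840 + 67x⁹/6720 ) / (2+√(1−x²)) < arcsin x − 3x/(2+√(1−x²)) < ( x⁵/60 + 11x⁷/840 + (π − 509/168)·x⁹ ) / (2+√(1−x²)). -/
open Real

theorem aux_low (t : ℝ) (h0 : 0 < t) (h1 : t < π / 2) :
    3 * sin t + sin t ^ 5 / 60 + 11 * sin t ^ 7 / 840 + 67 * sin t ^ 9 / 6720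
      < t * (2 + cos t) := by
  have hD : ∀ u : ℝ, 0 < 2 + cos u := fun u => by linarith [neg_one_le_cos u]
  let f : ℝ → ℝ := fun u => u - (3 * sin u + sin u ^ 5 / 60 + 11 * sin u ^ 7 / 840
    + 67 * sin u ^ 9 / 6720) / (2 + cos u)
  have hf : StrictMonoOn f (Set.Icc 0 (π / 2)) := by
    apply strictMonoOn_of_deriv_pos (convex_Icc _ _)
    · apply Continuous.continuousOn
      have : ∀ u : ℝ, 2 + cos u ≠ 0 := fun u => (hD u).ne'
      fun_prop (disch := assumption)
    · intro u hu
      rw [interior_Icc] at hu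
      have hs := hasDerivAt_sin u
      have hc := hasDerivAt_cos u
      have H : HasDerivAt f _ u := (hasDerivAt_id u).sub
        (((((hs.const_mul 3).add ((hs.pow 5).div_const 60)).add
          (((hs.pow 7).const_mul 11).div_const 840)).add
          (((hs.pow 9).const_mul 67).div_const 6720)).div (hc.const_add 2) (hD u).ne')
      rw [H.deriv]
      have c0 : 0 < cos u := cos_pos_of_mem_Ioo ⟨by linarith [hu.1, pi_pos], hu.2⟩
      have c1 : cos u < 1 := by
        have := cos_lt_cos_of_nonneg_of_le_pi_div_two le_rfl hu.2.le hu.1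
        simpa using this
      have s2 : sin u ^ 2 = 1 - cos u ^ 2 := sin_sq u
      have hp := hD u
      simp only [Pi.add_apply, Pi.pow_apply, Pi.mul_apply, Pi.div_apply]
      generalize cos u = c at *
      generalize sin u = s at *
      have s4 : s ^ 4 = (1 - c ^ 2) ^ 2 := by rw [← s2]; ring
      have s6 : s ^ 6 = (1 - c ^ 2) ^ 3 := by rw [← s2]; ring
      have s8 : s ^ 8 = (1 - c ^ 2) ^ 4 := by rw [← s2]; ring
      have s10 : s ^ 10 = (1 - c ^ 2) ^ 5 := by rw [← s2]; ring
      have pos : 0 < (1 - c) ^ 5 * (6453 + 15267 * c + 17769 * c ^ 2 + 11465 * c ^ 3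
          + 3886 * c ^ 4 + 536 * c ^ 5) / 6720 / (2 + c) ^ 2 := by
        have : 0 < 1 - c := by linarith
        positivity
      convert pos using 1
      have hne := hp.ne'
      rw [eq_div_iff (by positivity), sub_mul, div_mul_cancel₀ _ (by positivity)]
      push_cast
      norm_num
      linear_combination (-3) * s2 + (-c / 6 - c ^ 2 / 12) * s4
        + (-11 * c / 60 - 11 * c ^ 2 / 120 - 1 / 60) * s6
        + (-201 * c / 1120 - 201 * c ^ 2 / 2240 - 11 / 840) * s8 - 67 / 6720 * s10
  have h := hf ⟨le_rfl, by positivity⟩ ⟨h0.le, h1.le⟩ h0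
  simp only [f] at h
  simp at h
  rwa [div_lt_iff₀ (hD t)] at h

theorem aux_up (t : ℝ) (h0 : 0 < t) (h1 : t < π / 2) :
    t * (1 + 18 * cos t + 8 * cos t ^ 2) <
      sin t * (2 + 25 * cos t + cos t * (sin t ^ 4 / 15 + 11 * sin t ^ 6 / 420)) := by
  have hD : ∀ u ∈ Set.Icc 0 (π / 2), 0 < 1 + 18 * cos u + 8 * cos u ^ 2 := fun u hu => by
    have : 0 ≤ cos u := cos_nonneg_of_mem_Icc ⟨by linarith [hu.1, pi_pos], hu.2⟩
    positivity
  let f : ℝ → ℝ := fun u => sin u * (2 + 25 * cos u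
    + cos u * (sin u ^ 4 / 15 + 11 * sin u ^ 6 / 420)) / (1 + 18 * cos u + 8 * cos u ^ 2) - u
  have hf : StrictMonoOn f (Set.Icc 0 (π / 2)) := by
    apply strictMonoOn_of_deriv_pos (convex_Icc _ _)
    · apply ContinuousOn.sub _ (by fun_prop)
      apply ContinuousOn.div (by fun_prop) (by fun_prop)
      intro u hu
      exact (hD u hu).ne'
    · intro u hu
      rw [interior_Icc] at hu
      have hp := hD u ⟨hu.1.le, hu.2.le⟩
      have hs := hasDerivAt_sin u
      have hc := hasDerivAt_cos u
      have H : HasDerivAt f _ u := ((hs.mul (((hc.const_mul 25).const_add 2).add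
        (hc.mul (((hs.pow 4).div_const 15).add (((hs.pow 6).const_mul 11).div_const 420))))).div
        (((hc.const_mul 18).const_add 1).add ((hc.pow 2).const_mul 8)) hp.ne').sub
        (hasDerivAt_id u)
      rw [H.deriv]
      have c0 : 0 < cos u := cos_pos_of_mem_Ioo ⟨by linarith [hu.1, pi_pos], hu.2⟩
      have c1 : cos u < 1 := by
        have := cos_lt_cos_of_nonneg_of_le_pi_div_two le_rfl hu.2.le hu.1
        simpa using this
      have s2 : sin u ^ 2 = 1 - cos u ^ 2 := sin_sq u
      simp only [Pi.add_apply, Pi.pow_apply, Pi.mul_apply]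
      generalize cos u = c at *
      generalize sin u = s at *
      have s4 : s ^ 4 = (1 - c ^ 2) ^ 2 := by rw [← s2]; ring
      have s6 : s ^ 6 = (1 - c ^ 2) ^ 3 := by rw [← s2]; ring
      have s8 : s ^ 8 = (1 - c ^ 2) ^ 4 := by rw [← s2]; ring
      have pos : 0 < (1 - c) ^ 5 * (1387 + 6655 * c + 7024 * c ^ 2 + 4182 * c ^ 3
          + 1342 * c ^ 4 + 176 * c ^ 5) / 140 / (1 + 18 * c + 8 * c ^ 2) ^ 2 := by
        have : 0 < 1 - c := by linarith
        positivity
      convert pos using 1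
      rw [eq_div_iff (by positivity), sub_mul, div_mul_cancel₀ _ (by positivity)]
      push_cast
      norm_num
      linear_combination (-25 * (1 + 18 * c + 8 * c ^ 2) + (2 + 25 * c) * (18 + 16 * c)) * s2
        + c ^ 2 / 3 * (1 + 18 * c + 8 * c ^ 2) * s4
        + ((-1 / 15 + 77 / 420 * c ^ 2) * (1 + 18 * c + 8 * c ^ 2)
          + c / 15 * (18 + 16 * c)) * s6
        + (-11 / 420 * (1 + 18 * c + 8 * c ^ 2) + 11 * c / 420 * (18 + 16 * c)) * s8
  have h := hf ⟨le_rfl, by positivity⟩ ⟨h0.le, h1.le⟩ h0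
  simp only [f] at h
  simp only [sin_zero, zero_mul, zero_div, sub_zero] at h
  rwa [sub_pos, lt_div_iff₀ (hD t ⟨h0.le, h1.le⟩)] at h

theorem shaferE_n4 (x : ℝ) (hx : x ∈ Set.Ioo (0 : ℝ) 1) :
    (x ^ 5 / 60 + 11 * x ^ 7 / 840 + 67 * x ^ 9 / 6720) / (2 + Real.sqrt (1 - x ^ 2))
      < Real.arcsin x - 3 * x / (2 + Real.sqrt (1 - x ^ 2)) ∧
    Real.arcsin x - 3 * x / (2 + Real.sqrt (1 - x ^ 2))
      < (x ^ 5 / 60 + 11 * x ^ 7 / 840 + (π - 509 / 168) * x ^ 9)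
        / (2 + Real.sqrt (1 - x ^ 2)) := by
  have t0 : 0 < arcsin x := arcsin_pos.2 hx.1
  have t1 : arcsin x < π / 2 := arcsin_lt_pi_div_two.2 hx.2
  have hs : sin (arcsin x) = x := sin_arcsin (by linarith [hx.1]) hx.2.le
  rw [← cos_arcsin]
  generalize arcsin x = t at *
  subst hs
  have hD : 0 < 2 + cos t := by linarith [neg_one_le_cos t]
  constructor
  · rw [lt_sub_iff_add_lt, ← add_div, div_lt_iff₀ hD]
    linarith [aux_low t t0 t1]
  rw [sub_lt_iff_lt_add, ← add_div, lt_div_iff₀ hD]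
  let g : ℝ → ℝ := fun u => ((2 + cos u) * u - 3 * sin u - sin u ^ 5 / 60
    - 11 * sin u ^ 7 / 840) / sin u ^ 9
  have spos : ∀ u ∈ Set.Ioc 0 (π / 2), 0 < sin u := fun u hu =>
    sin_pos_of_pos_of_lt_pi hu.1 (by linarith [hu.2, pi_pos])
  have hg : StrictMonoOn g (Set.Ioc 0 (π / 2)) := by
    apply strictMonoOn_of_deriv_pos (convex_Ioc _ _)
    · apply ContinuousOn.div (by fun_prop) (by fun_prop)
      intro u hu
      exact (pow_pos (spos u hu) 9).ne'
    · intro u hu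
      rw [interior_Ioc] at hu
      have sp := spos u ⟨hu.1, hu.2.le⟩
      have hs := hasDerivAt_sin u
      have hc := hasDerivAt_cos u
      have H : HasDerivAt g _ u := (((((hc.const_add 2).mul (hasDerivAt_id u)).sub
        (hs.const_mul 3)).sub ((hs.pow 5).div_const 60)).sub
          (((hs.pow 7).const_mul 11).div_const 840)).div (hs.pow 9) (pow_pos sp 9).ne'
      rw [H.deriv]
      have key := aux_up u hu.1 hu.2
      have s2 : sin u ^ 2 = 1 - cos u ^ 2 := sin_sq u
      simp only [Pi.add_apply, Pi.sub_apply, Pi.pow_apply, Pi.mul_apply, Pi.div_apply, id]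
      generalize cos u = c at *
      generalize sin u = s at *
      apply div_pos _ (by positivity)
      have pos := mul_pos (pow_pos sp 8) (sub_pos.2 key)
      convert pos using 1
      push_cast
      norm_num
      linear_combination (-u * s ^ 8) * s2
  have h := hg ⟨t0, t1.le⟩ ⟨by positivity, le_rfl⟩ t1
  simp only [g] at h
  rw [div_lt_iff₀ (pow_pos (spos t ⟨t0, t1.le⟩) 9)] at h
  simp only [cos_pi_div_two, sin_pi_div_two] at h
  linarith
end
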